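/- arXiv:2307.11690 — 9 statements merged into one kernel-verified Lean document; each statement's English description precedes it below -/
import Mathlib

section
/- For every natural number k, every natural number m with m < 2^k, and all real numbers x₀, x₁ in the interval [m/2^k, (m+1)/2^k], one has d(b(x₀), b(x₁)) ≤ 2^{−k}. -/
open Filter

/-- The Besicovitch pseudodistance on `2^ω`:
`d(X,Y) = limsup_{n→∞} |{m < n : X(m) ≠ Y(m)}|/n`. -/
noncomputable def besic (X Y : ℕ → Bool) : ℝ :=
  Filter.limsup
    (fun n => (((Finset.range n).filter (fun m => X m ≠ Y m)).card : ℝ) / n)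
    Filter.atTop

/-- The dyadic threshold `t n` such that `b(r)(n) = 1 ↔ r ≥ t n`.
It satisfies `t 0 = 1`, `t (2n) = (1 + t n)/2` (for `n ≥ 1`) and `t (2n+1) = t n / 2`. -/
noncomputable def bThresh : ℕ → ℝ
  | 0 => 1
  | (n + 1) =>
      if (n + 1) % 2 = 0 then (1 + bThresh ((n + 1) / 2)) / 2
      else bThresh ((n + 1) / 2) / 2
decreasing_by all_goals exact Nat.div_lt_self (Nat.succ_pos n) one_lt_two

/-- The sequence `b(r) ∈ 2^ω` from the recursion `b(0) = 0^ω`, `b(1) = 1^ω`,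
`b(r) = 0^ω ⊕ b(2r)` for `0 < r ≤ 1/2` and `b(r) = b(2r−1) ⊕ 1^ω` for `1/2 ≤ r < 1`
(each bit is determined at a finite stage; this closed form records precisely the
outcome of that recursion: bit `n` of `b(r)` is `1` iff `r ≥ t n`). -/
noncomputable def bseq (r : ℝ) (n : ℕ) : Bool := decide (bThresh n ≤ r)

/-- Number of ones of `X` among positions `< n`. -/
def onesCount (X : ℕ → Bool) (n : ℕ) : ℕ :=
  ((Finset.range n).filter (fun m => X m = true)).card

theorem bThresh_two_mul (n : ℕ) : bThresh (2 * n) = (1 + bThresh n) / 2 := by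
  cases n with
  | zero => norm_num [bThresh]
  | succ n =>
    rw [show 2 * (n + 1) = (2 * n + 1) + 1 by ring, bThresh]
    rw [if_pos (by omega), show (2 * n + 1 + 1) / 2 = n + 1 by omega]

theorem bThresh_two_mul_add_one (n : ℕ) : bThresh (2 * n + 1) = bThresh n / 2 := by
  rw [bThresh, if_neg (by omega), show (2 * n + 1) / 2 = n by omega]

theorem bThresh_mem_Ioc (n : ℕ) : bThresh n ∈ Set.Ioc (0 : ℝ) 1 := by
  induction n using Nat.strong_induction_on with
  | _ n ih =>
    rcases Nat.eq_zero_or_pos n with rfl | hn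
    · norm_num [bThresh]
    · obtain ⟨h0, h1⟩ := ih (n / 2) (by omega)
      rcases Nat.even_or_odd' n with ⟨c, rfl | rfl⟩
      · rw [show 2 * c / 2 = c by omega] at h0 h1
        rw [bThresh_two_mul]
        constructor <;> linarith
      · rw [show (2 * c + 1) / 2 = c by omega] at h0 h1
        rw [bThresh_two_mul_add_one]
        constructor <;> linarith

/-- Positions whose thresholds lie in a common dyadic interval of length `2⁻ᵏ` are congruent
modulo `2 ^ k`. -/
theorem modEq_of_bThresh_mem_Ioc (k : ℕ) (m : ℤ) (a b : ℕ)
    (ha : 2 ^ k * bThresh a ∈ Set.Ioc (m : ℝ) (m + 1))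
    (hb : 2 ^ k * bThresh b ∈ Set.Ioc (m : ℝ) (m + 1)) : a ≡ b [MOD 2 ^ k] := by
  induction k generalizing m a b with
  | zero => simpa using Nat.modEq_one
  | succ k ih =>
    have even_bound (c : ℕ) (hc : 2 ^ (k + 1) * bThresh (2 * c) ∈ Set.Ioc (m : ℝ) (m + 1)) :
        2 ^ k * bThresh c ∈ Set.Ioc ((m - 2 ^ k : ℤ) : ℝ) ((m - 2 ^ k : ℤ) + 1) ∧
          2 ^ k ≤ m := by
      rw [bThresh_two_mul, pow_succ] at hc
      obtain ⟨h0, h1⟩ := hc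
      have hpos : 0 < (2 : ℝ) ^ k * bThresh c := by
        have := (bThresh_mem_Ioc c).1
        positivity
      refine ⟨⟨by push_cast; linarith, by push_cast; linarith⟩, ?_⟩
      have : ((2 ^ k : ℤ) : ℝ) < ((m + 1 : ℤ) : ℝ) := by push_cast; linarith
      exact Int.lt_add_one_iff.mp (by exact_mod_cast this)
    have odd_bound (c : ℕ) (hc : 2 ^ (k + 1) * bThresh (2 * c + 1) ∈ Set.Ioc (m : ℝ) (m + 1)) :
        2 ^ k * bThresh c ∈ Set.Ioc (m : ℝ) (m + 1) ∧ m < 2 ^ k := by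
      rw [bThresh_two_mul_add_one, pow_succ] at hc
      obtain ⟨h0, h1⟩ := hc
      have hle : (2 : ℝ) ^ k * bThresh c ≤ 2 ^ k :=
        mul_le_of_le_one_right (by positivity) (bThresh_mem_Ioc c).2
      refine ⟨⟨by linarith, by linarith⟩, ?_⟩
      have : (m : ℝ) < ((2 ^ k : ℤ) : ℝ) := by push_cast; linarith
      exact_mod_cast this
    rw [pow_succ']
    rcases Nat.even_or_odd' a with ⟨c, rfl | rfl⟩ <;>
      rcases Nat.even_or_odd' b with ⟨d, rfl | rfl⟩
    · exact (ih _ _ _ (even_bound c ha).1 (even_bound d hb).1).mul_left' 2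
    · exact absurd (even_bound c ha).2 (not_le.mpr (odd_bound d hb).2)
    · exact absurd (even_bound d hb).2 (not_le.mpr (odd_bound c ha).2)
    · exact ((ih _ _ _ (odd_bound c ha).1 (odd_bound d hb).1).mul_left' 2).add_right 1

theorem bThresh_mem_Ioc_of_bseq_ne {u v x y : ℝ} (hx : x ∈ Set.Icc u v) (hy : y ∈ Set.Icc u v)
    {n : ℕ} (h : bseq x n ≠ bseq y n) : bThresh n ∈ Set.Ioc u v := by
  obtain ⟨hx0, hx1⟩ := hx
  obtain ⟨hy0, hy1⟩ := hy
  simp only [bseq, ne_eq, decide_eq_decide] at h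
  by_cases hnx : bThresh n ≤ x
  · have hny : ¬ bThresh n ≤ y := fun hny => h (iff_of_true hnx hny)
    exact ⟨by linarith, by linarith⟩
  · have hny : bThresh n ≤ y := by
      by_contra hny
      exact h (iff_of_false hnx hny)
    exact ⟨by linarith, by linarith⟩

/-- A set of naturals that are pairwise congruent modulo `r` has at most `n / r + 1` elements
below `n`. -/
theorem card_filter_range_le_of_modEq {p : ℕ → Prop} [DecidablePred p] {r : ℕ} (hr : 0 < r)
    (hp : ∀ a b, p a → p b → a ≡ b [MOD r]) (n : ℕ) :
    ((Finset.range n).filter p).card ≤ n / r + 1 := by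
  by_cases h : ∃ v, p v
  · obtain ⟨v, hv⟩ := h
    calc ((Finset.range n).filter p).card
        ≤ ((Finset.range n).filter (· ≡ v [MOD r])).card :=
          Finset.card_le_card (Finset.monotone_filter_right _ fun a _ ha => hp a v ha hv)
      _ = n.count (· ≡ v [MOD r]) := (Nat.count_eq_card_filter_range _ _).symm
      _ ≤ n / r + 1 := by
        rw [Nat.count_modEq_card n hr v]
        split_ifs <;> omega
  · push Not at h
    simp [h]

/-- If `X` and `Y` differ only at positions that are pairwise congruent modulo `r`, then their
Besicovitch distance is at most `1 / r`. -/
theorem besic_le_of_modEq {X Y : ℕ → Bool} {r : ℕ} (hr : 0 < r)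
    (h : ∀ a b, X a ≠ Y a → X b ≠ Y b → a ≡ b [MOD r]) : besic X Y ≤ 1 / r := by
  have hlim : Tendsto (fun n : ℕ => 1 / (r : ℝ) + 1 / (n : ℝ)) atTop (nhds (1 / r)) := by
    simpa using tendsto_const_nhds.add (tendsto_one_div_atTop_nhds_zero_nat (𝕜 := ℝ))
  rw [besic, ← hlim.limsup_eq]
  refine limsup_le_limsup ?_ ?_ hlim.isBoundedUnder_le
  · filter_upwards [eventually_gt_atTop 0] with n hn
    have hn' : (0 : ℝ) < n := by exact_mod_cast hn
    have hcard : (((Finset.range n).filter (fun m => X m ≠ Y m)).card : ℝ) ≤ n / r + 1 := by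
      calc _ ≤ ((n / r + 1 : ℕ) : ℝ) := by
            exact_mod_cast card_filter_range_le_of_modEq hr h n
        _ ≤ n / r + 1 := by
            push_cast
            gcongr
            exact Nat.cast_div_le
    calc _ ≤ ((n : ℝ) / r + 1) / n := by gcongr
      _ = 1 / r + 1 / n := by
        have : (r : ℝ) ≠ 0 := by positivity
        field_simp
  · exact IsBoundedUnder.isCoboundedUnder_le ⟨0, by
      simp only [eventually_map]
      exact Eventually.of_forall fun n => by positivity⟩

/-- For every `k`, `m < 2^k`, and `x0, x1` in `[m/2^k, (m+1)/2^k]`, we have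
`d(b(x0), b(x1)) <= 2^(-k)`. -/
theorem stmt_3 (k m : ℕ) (hm : m < 2 ^ k) (x₀ x₁ : ℝ)
    (hx₀ : x₀ ∈ Set.Icc ((m : ℝ) / 2 ^ k) (((m : ℝ) + 1) / 2 ^ k))
    (hx₁ : x₁ ∈ Set.Icc ((m : ℝ) / 2 ^ k) (((m : ℝ) + 1) / 2 ^ k)) :
    besic (bseq x₀) (bseq x₁) ≤ 1 / 2 ^ k := by
  have hpow : (0 : ℝ) < 2 ^ k := by positivity
  have scale (n : ℕ) (hn : bseq x₀ n ≠ bseq x₁ n) :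
      2 ^ k * bThresh n ∈ Set.Ioc ((m : ℤ) : ℝ) ((m : ℤ) + 1) := by
    obtain ⟨h0, h1⟩ := bThresh_mem_Ioc_of_bseq_ne hx₀ hx₁ hn
    rw [div_lt_iff₀' hpow] at h0
    rw [le_div_iff₀' hpow] at h1
    exact ⟨by exact_mod_cast h0, by exact_mod_cast h1⟩
  have h := besic_le_of_modEq (r := 2 ^ k) (by positivity) fun a b ha hb =>
    modEq_of_bThresh_mem_Ioc k m a b (scale a ha) (scale b hb)
  exact_mod_cast h
end

section
/- For every r ∈ [0,1], the density of 1's in the sequence b(r) exists and equals r, i.e., lim_{n→∞} |{m < n : b(r)(m) = 1}|/n = r. -/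
open Filter

theorem bseq_two_mul (r : ℝ) (n : ℕ) : bseq r (2 * n) = bseq (2 * r - 1) n := by
  simp only [bseq, bThresh_two_mul, decide_eq_decide]
  constructor <;> intro h <;> linarith

theorem bseq_two_mul_add_one (r : ℝ) (n : ℕ) : bseq r (2 * n + 1) = bseq (2 * r) n := by
  simp only [bseq, bThresh_two_mul_add_one, decide_eq_decide]
  constructor <;> intro h <;> linarith

theorem onesCount_zero (X : ℕ → Bool) : onesCount X 0 = 0 := by
  simp [onesCount]

theorem onesCount_succ (X : ℕ → Bool) (n : ℕ) :
    onesCount X (n + 1) = onesCount X n + (X n).toNat := by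
  unfold onesCount
  rw [Finset.range_add_one, Finset.filter_insert]
  cases h : X n <;> simp

theorem onesCount_le (X : ℕ → Bool) (n : ℕ) : onesCount X n ≤ n := by
  simpa [onesCount] using Finset.card_filter_le (Finset.range n) (fun m => X m = true)

theorem onesCount_bseq_two_mul (r : ℝ) (n : ℕ) :
    onesCount (bseq r) (2 * n) =
      onesCount (bseq (2 * r - 1)) n + onesCount (bseq (2 * r)) n := by
  induction n with
  | zero => simp [onesCount_zero]
  | succ n ih =>
    rw [show 2 * (n + 1) = 2 * n + 1 + 1 by ring, onesCount_succ, onesCount_succ, ih,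
      onesCount_succ, onesCount_succ, bseq_two_mul, bseq_two_mul_add_one]
    ring

theorem onesCount_bseq_two_mul_add_one (r : ℝ) (n : ℕ) :
    onesCount (bseq r) (2 * n + 1) =
      onesCount (bseq (2 * r - 1)) (n + 1) + onesCount (bseq (2 * r)) n := by
  rw [onesCount_succ, onesCount_succ, onesCount_bseq_two_mul, bseq_two_mul]
  ring

theorem onesCount_bseq_of_nonpos {r : ℝ} (hr : r ≤ 0) (n : ℕ) :
    onesCount (bseq r) n = 0 := by
  simp only [onesCount, bseq, decide_eq_true_eq, Finset.card_eq_zero, Finset.filter_eq_empty_iff]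
  intro m _ h
  linarith [(bThresh_mem_Ioc m).1]

theorem onesCount_bseq_of_one_le {r : ℝ} (hr : 1 ≤ r) (n : ℕ) :
    onesCount (bseq r) n = n := by
  have h : ∀ m, bThresh m ≤ r := fun m => (bThresh_mem_Ioc m).2.trans hr
  simp [onesCount, bseq, h]

/-- The discrepancy of `bseq r` grows at most logarithmically. -/
theorem abs_onesCount_bseq_sub_le (k : ℕ) {r : ℝ} (hr : r ∈ Set.Icc (0 : ℝ) 1) {n : ℕ}
    (hn : n ≤ 2 ^ k) : |(onesCount (bseq r) n : ℝ) - r * n| ≤ k + 1 := by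
  induction k generalizing r n with
  | zero =>
    obtain ⟨h₀, h₁⟩ := hr
    have hn' : (n : ℝ) ≤ 1 := by exact_mod_cast hn
    have hc : (onesCount (bseq r) n : ℝ) ≤ n := by exact_mod_cast onesCount_le _ _
    have hc₀ : (0 : ℝ) ≤ onesCount (bseq r) n := Nat.cast_nonneg _
    have hn₀ : (0 : ℝ) ≤ n := Nat.cast_nonneg _
    rw [abs_le]
    constructor <;> push_cast <;> nlinarith
  | succ k ih =>
    obtain ⟨h₀, h₁⟩ := hr
    rw [pow_succ] at hn
    obtain ⟨m, rfl | rfl⟩ := Nat.even_or_odd' n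
    · rw [onesCount_bseq_two_mul]
      rcases le_total r (1 / 2) with h | h
      · rw [onesCount_bseq_of_nonpos (by linarith : 2 * r - 1 ≤ 0)]
        have := abs_le.1 (ih (r := 2 * r) (n := m) ⟨by linarith, by linarith⟩ (by omega))
        rw [abs_le]
        constructor <;> push_cast <;> linarith
      · rw [onesCount_bseq_of_one_le (by linarith : 1 ≤ 2 * r)]
        have := abs_le.1 (ih (r := 2 * r - 1) (n := m) ⟨by linarith, by linarith⟩ (by omega))
        rw [abs_le]
        constructor <;> push_cast <;> linarith
    · rw [onesCount_bseq_two_mul_add_one]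
      rcases le_total r (1 / 2) with h | h
      · rw [onesCount_bseq_of_nonpos (by linarith : 2 * r - 1 ≤ 0)]
        have := abs_le.1 (ih (r := 2 * r) (n := m) ⟨by linarith, by linarith⟩ (by omega))
        rw [abs_le]
        constructor <;> push_cast <;> linarith
      · rw [onesCount_bseq_of_one_le (by linarith : 1 ≤ 2 * r)]
        have := abs_le.1 (ih (r := 2 * r - 1) (n := m + 1) ⟨by linarith, by linarith⟩ (by omega))
        push_cast at this
        rw [abs_le]
        constructor <;> push_cast <;> linarith

theorem tendsto_natLog_two_add_div_atTop (c : ℝ) :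
    Tendsto (fun n : ℕ => ((Nat.log 2 n : ℝ) + c) / n) atTop (nhds 0) := by
  have hlog : Tendsto (fun n : ℕ => Real.logb 2 n / n) atTop (nhds 0) := by
    have h := (Real.isLittleO_log_id_atTop.tendsto_div_nhds_zero.comp
      (tendsto_natCast_atTop_atTop (R := ℝ))).div_const (Real.log 2)
    simp only [zero_div] at h
    refine h.congr fun n => ?_
    simp only [Function.comp, id, Real.logb]
    ring
  have hnat : Tendsto (fun n : ℕ => (Nat.log 2 n : ℝ) / n) atTop (nhds 0) :=
    squeeze_zero (fun n => by positivity)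
      (fun n => by gcongr; exact_mod_cast Real.natLog_le_logb n 2) hlog
  simpa [add_div] using hnat.add (tendsto_const_div_atTop_nhds_zero_nat c)

/-- For every `r` in `[0,1]`, the density of ones in `b(r)` exists and equals `r`. -/
theorem stmt_5 (r : ℝ) (hr : r ∈ Set.Icc (0 : ℝ) 1) :
    Filter.Tendsto (fun n => (onesCount (bseq r) n : ℝ) / n)
      Filter.atTop (nhds r) := by
  rw [tendsto_iff_norm_sub_tendsto_zero]
  refine squeeze_zero' (Eventually.of_forall fun _ => norm_nonneg _) ?_
    (tendsto_natLog_two_add_div_atTop 2)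
  filter_upwards [eventually_gt_atTop 0] with n hn
  have hn' : (0 : ℝ) < n := by exact_mod_cast hn
  have h := abs_onesCount_bseq_sub_le (Nat.log 2 n + 1) hr
    (Nat.lt_pow_succ_log_self one_lt_two n).le
  rw [Real.norm_eq_abs, div_sub' hn'.ne', abs_div, abs_of_pos hn', mul_comm (n : ℝ) r]
  gcongr
  push_cast at h
  linarith
end

section
/- If r = m/2^k is a dyadic rational in [0,1] (with m, k natural numbers, m ≤ 2^k), then the sequence b(r) is periodic with period 2^k, and each block of b(r) of length 2^k starting at a multiple of 2^k contains exactly m ones. -/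
open Filter

theorem bThresh_le_intCast_iff (n : ℕ) (m : ℤ) : bThresh n ≤ m ↔ 1 ≤ m := by
  obtain ⟨h₀, h₁⟩ := bThresh_mem_Ioc n
  constructor
  · intro h
    have : (0 : ℝ) < m := h₀.trans_le h
    exact_mod_cast this
  · intro h
    exact h₁.trans (by exact_mod_cast h)

theorem bThresh_two_mul_le_iff (n k : ℕ) (m : ℤ) :
    bThresh (2 * n) ≤ (m : ℝ) / 2 ^ (k + 1) ↔
      bThresh n ≤ ((m - 2 ^ k : ℤ) : ℝ) / 2 ^ k := by
  have h : ((m - 2 ^ k : ℤ) : ℝ) / 2 ^ k = 2 * ((m : ℝ) / 2 ^ (k + 1)) - 1 := by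
    push_cast
    field_simp
    ring
  rw [bThresh_two_mul, h]
  constructor <;> intro <;> linarith

theorem bThresh_two_mul_add_one_le_iff (n k : ℕ) (m : ℤ) :
    bThresh (2 * n + 1) ≤ (m : ℝ) / 2 ^ (k + 1) ↔ bThresh n ≤ (m : ℝ) / 2 ^ k := by
  have h : (m : ℝ) / 2 ^ k = 2 * ((m : ℝ) / 2 ^ (k + 1)) := by
    field_simp
    ring
  rw [bThresh_two_mul_add_one, h]
  constructor <;> intro <;> linarith

theorem bThresh_add_two_pow_le_iff (k : ℕ) (m : ℤ) (n : ℕ) :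
    bThresh (n + 2 ^ k) ≤ (m : ℝ) / 2 ^ k ↔ bThresh n ≤ (m : ℝ) / 2 ^ k := by
  induction k generalizing m n with
  | zero => simp only [pow_zero, div_one, bThresh_le_intCast_iff]
  | succ k ih =>
    obtain ⟨a, rfl | rfl⟩ := n.even_or_odd'
    · rw [show 2 * a + 2 ^ (k + 1) = 2 * (a + 2 ^ k) by ring,
        bThresh_two_mul_le_iff, bThresh_two_mul_le_iff, ih]
    · rw [show 2 * a + 1 + 2 ^ (k + 1) = 2 * (a + 2 ^ k) + 1 by ring,
        bThresh_two_mul_add_one_le_iff, bThresh_two_mul_add_one_le_iff, ih]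

theorem card_filter_Ico_two_mul (p : ℕ → Prop) [DecidablePred p] {a b : ℕ} (hab : a ≤ b) :
    ((Finset.Ico (2 * a) (2 * b)).filter p).card =
      ((Finset.Ico a b).filter fun i => p (2 * i)).card +
        ((Finset.Ico a b).filter fun i => p (2 * i + 1)).card := by
  simp only [Finset.card_filter]
  induction b, hab using Nat.le_induction with
  | base => simp
  | succ b hab ih =>
    rw [show 2 * (b + 1) = 2 * b + 1 + 1 by ring, Finset.sum_Ico_succ_top (by omega),
      Finset.sum_Ico_succ_top (by omega), Finset.sum_Ico_succ_top hab,
      Finset.sum_Ico_succ_top hab, ih]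
    ring

theorem card_filter_bThresh_le (k : ℕ) (m : ℤ) (j : ℕ) :
    (((Finset.Ico (j * 2 ^ k) ((j + 1) * 2 ^ k)).filter
      (fun i => bThresh i ≤ (m : ℝ) / 2 ^ k)).card : ℤ) = max 0 (min m (2 ^ k)) := by
  induction k generalizing m with
  | zero =>
    simp only [pow_zero, div_one, mul_one, bThresh_le_intCast_iff, Finset.filter_const]
    split_ifs <;> simp <;> omega
  | succ k ih =>
    rw [show j * 2 ^ (k + 1) = 2 * (j * 2 ^ k) by ring,
      show (j + 1) * 2 ^ (k + 1) = 2 * ((j + 1) * 2 ^ k) by ring,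
      card_filter_Ico_two_mul _ (Nat.mul_le_mul_right _ j.le_succ)]
    simp only [bThresh_two_mul_le_iff, bThresh_two_mul_add_one_le_iff]
    rw [Nat.cast_add, ih, ih, pow_succ]
    have : (0 : ℤ) < 2 ^ k := by positivity
    omega

/-- If `r = m/2^k` is a dyadic rational in `[0,1]`, then `b(r)` is periodic with
period `2^k`, and each block of length `2^k` starting at a multiple of `2^k`
contains exactly `m` ones. -/
theorem stmt_6 (m k : ℕ) (hm : m ≤ 2 ^ k) :
    (∀ n : ℕ, bseq ((m : ℝ) / 2 ^ k) (n + 2 ^ k) = bseq ((m : ℝ) / 2 ^ k) n) ∧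
    (∀ j : ℕ,
      ((Finset.Ico (j * 2 ^ k) ((j + 1) * 2 ^ k)).filter
          (fun i => bseq ((m : ℝ) / 2 ^ k) i = true)).card = m) := by
  constructor
  · intro n
    have h := bThresh_add_two_pow_le_iff k m n
    rw [Int.cast_natCast] at h
    simp only [bseq, h]
  · intro j
    have h := card_filter_bThresh_le k m j
    rw [Int.cast_natCast] at h
    have hm' : (m : ℤ) ≤ 2 ^ k := by exact_mod_cast hm
    rw [min_eq_left hm', max_eq_right (Int.natCast_nonneg m)] at h
    simp only [bseq, decide_eq_true_eq]
    exact_mod_cast h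
end

section
/- Let s ∈ [0,1) and let c = 1 − 2^{s−1}. Then for every d ∈ (0, 1/2], (s − 1 + H(d))/d ≤ (s − 1 + H(c))/c; that is, the function d ↦ (s − 1 + H(d))/d on (0, 1/2] attains its maximum at d = c. -/
/-- The binary entropy function `H(p) = -p log2 p - (1-p) log2 (1-p)`
(with `H(0) = H(1) = 0`, using the convention `logb 2 0 = 0`). -/
noncomputable def H (p : ℝ) : ℝ :=
  -p * Real.logb 2 p - (1 - p) * Real.logb 2 (1 - p)

/-- The pointwise inequality behind Gibbs' inequality. -/
theorem mul_log_sub_log_le_sub {x y : ℝ} (hx : 0 < x) (hy : 0 < y) :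
    x * (Real.log y - Real.log x) ≤ y - x := by
  have h := mul_le_mul_of_nonneg_left (Real.log_le_sub_one_of_pos (div_pos hy hx)) hx.le
  rw [Real.log_div hy.ne' hx.ne'] at h
  calc x * (Real.log y - Real.log x) ≤ x * (y / x - 1) := h
    _ = y - x := by field_simp

/-- Gibbs' inequality: the binary entropy is at most the binary cross-entropy. -/
theorem H_le_crossEntropy {p q : ℝ} (hp : p ∈ Set.Ioo (0 : ℝ) 1) (hq : q ∈ Set.Ioo (0 : ℝ) 1) :
    H p ≤ -p * Real.logb 2 q - (1 - p) * Real.logb 2 (1 - q) := by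
  have h₁ := mul_log_sub_log_le_sub hp.1 hq.1
  have h₂ := mul_log_sub_log_le_sub (sub_pos.2 hp.2) (sub_pos.2 hq.2)
  have hlog : 0 < Real.log 2 := Real.log_pos one_lt_two
  simp only [H, Real.logb, mul_div_assoc', ← sub_div]
  refine div_le_div_of_nonneg_right ?_ hlog.le
  linarith

/-- For `s` in `[0,1)` and `c = 1 - 2^(s-1)`, the function `d ↦ (s - 1 + H(d))/d` on
`(0, 1/2]` attains its maximum at `d = c`. -/
theorem stmt_11 (s : ℝ) (hs : s ∈ Set.Ico (0 : ℝ) 1) (d : ℝ)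
    (hd : d ∈ Set.Ioc (0 : ℝ) (1 / 2)) :
    (s - 1 + H d) / d
      ≤ (s - 1 + H (1 - (2 : ℝ) ^ (s - 1))) / (1 - (2 : ℝ) ^ (s - 1)) := by
  obtain ⟨hd₀, hd₁⟩ := hd
  have hpos : (0 : ℝ) < 2 ^ (s - 1) := by positivity
  have hlt : (2 : ℝ) ^ (s - 1) < 1 :=
    Real.rpow_lt_one_of_one_lt_of_neg one_lt_two (by linarith [hs.2])
  have hL : Real.logb 2 (2 ^ (s - 1)) = s - 1 := Real.logb_rpow two_pos (by norm_num)
  generalize (2 : ℝ) ^ (s - 1) = t at *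
  have hc : 0 < 1 - t := sub_pos.2 hlt
  have hmax : (s - 1 + H (1 - t)) / (1 - t) = s - 1 - Real.logb 2 (1 - t) := by
    rw [div_eq_iff hc.ne', H, sub_sub_cancel, hL]
    ring
  have hgibbs := H_le_crossEntropy (p := d) (q := 1 - t) ⟨hd₀, by linarith⟩ ⟨hc, by linarith⟩
  rw [sub_sub_cancel, hL] at hgibbs
  rw [hmax, div_le_iff₀ hd₀]
  linarith
end

section
/- Let s ∈ (0,1), let c = 1 − 2^{s−1}, and define f : [0,1/2] → ℝ by f(d) = s − 1 + H(d) if d ≥ c and f(d) = ((s − 1 + H(c))/c)·d if d < c. Then f is strictly increasing on [0,1/2], with f(0) = 0 and f(1/2) = s. -/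
/-- The function `f` from the calculus lemma: `f(d) = s - 1 + H(d)` for `d >= c` and
`f(d) = ((s - 1 + H(c))/c) d` for `d < c`, where `c = 1 - 2^(s-1)`. -/
noncomputable def fGMSW (s d : ℝ) : ℝ :=
  if 1 - (2 : ℝ) ^ (s - 1) ≤ d then s - 1 + H d
  else ((s - 1 + H (1 - (2 : ℝ) ^ (s - 1))) / (1 - (2 : ℝ) ^ (s - 1))) * d

/-- The base-two entropy is the natural-logarithm entropy rescaled by `log 2`. -/
theorem H_eq_binEntropy_div (p : ℝ) : H p = Real.binEntropy p / Real.log 2 := by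
  simp only [H, Real.binEntropy, Real.logb, Real.log_inv]
  ring

theorem H_strictMonoOn : StrictMonoOn H (Set.Icc 0 (1 / 2)) := by
  intro x hx y hy hxy
  rw [one_div] at hx hy
  rw [H_eq_binEntropy_div, H_eq_binEntropy_div]
  exact div_lt_div_of_pos_right (Real.binEntropy_strictMonoOn hx hy hxy)
    (Real.log_pos one_lt_two)

theorem H_half : H (1 / 2) = 1 := by
  rw [H_eq_binEntropy_div, one_div, Real.binEntropy_two_inv]
  exact div_self (Real.log_pos one_lt_two).ne'

theorem one_sub_two_rpow_mem_Ioo {s : ℝ} (hs : s ∈ Set.Ioo (0 : ℝ) 1) :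
    1 - (2 : ℝ) ^ (s - 1) ∈ Set.Ioo (0 : ℝ) (1 / 2) := by
  have h_lt : (2 : ℝ) ^ (s - 1) < 1 :=
    Real.rpow_lt_one_of_one_lt_of_neg one_lt_two (by linarith [hs.2])
  have h_gt : (2 : ℝ) ^ (-1 : ℝ) < (2 : ℝ) ^ (s - 1) :=
    Real.rpow_lt_rpow_of_exponent_lt one_lt_two (by linarith [hs.1])
  rw [Real.rpow_neg_one] at h_gt
  constructor <;> linarith

/-- At the threshold `c = 1 - 2^(s-1)`, the value `s - 1 + H c` is positive. -/
theorem sub_one_add_H_pos {s : ℝ} (hs : s ∈ Set.Ioo (0 : ℝ) 1) :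
    0 < s - 1 + H (1 - (2 : ℝ) ^ (s - 1)) := by
  obtain ⟨hc_pos, hc_lt⟩ := one_sub_two_rpow_mem_Ioo hs
  have h_logb : Real.logb 2 ((2 : ℝ) ^ (s - 1)) = s - 1 :=
    Real.logb_rpow two_pos (by norm_num)
  have h_lt : Real.logb 2 (1 - (2 : ℝ) ^ (s - 1)) < s - 1 :=
    (Real.logb_lt_iff_lt_rpow one_lt_two hc_pos).2 (by linarith)
  have h_eq : s - 1 + H (1 - (2 : ℝ) ^ (s - 1)) =
      (1 - (2 : ℝ) ^ (s - 1)) * (s - 1 - Real.logb 2 (1 - (2 : ℝ) ^ (s - 1))) := by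
    rw [H, sub_sub_cancel, h_logb]
    ring
  rw [h_eq]
  exact mul_pos hc_pos (sub_pos.2 h_lt)

/-- For `s` in `(0,1)`, the function `f` is strictly increasing on `[0, 1/2]`, with
`f(0) = 0` and `f(1/2) = s`. -/
theorem stmt_12 (s : ℝ) (hs : s ∈ Set.Ioo (0 : ℝ) 1) :
    StrictMonoOn (fGMSW s) (Set.Icc (0 : ℝ) (1 / 2)) ∧
    fGMSW s 0 = 0 ∧ fGMSW s (1 / 2) = s := by
  obtain ⟨hc_pos, hc_lt⟩ := one_sub_two_rpow_mem_Ioo hs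
  have h_pos := sub_one_add_H_pos hs
  refine ⟨?_, ?_, ?_⟩
  · intro x hx y hy hxy
    simp only [fGMSW]
    set c := 1 - (2 : ℝ) ^ (s - 1)
    have h_slope : 0 < (s - 1 + H c) / c := div_pos h_pos hc_pos
    split_ifs with hcx hcy hcy
    · linarith [H_strictMonoOn hx hy hxy]
    · linarith
    · have h_left : (s - 1 + H c) / c * x < s - 1 + H c := by
        calc (s - 1 + H c) / c * x < (s - 1 + H c) / c * c :=
              mul_lt_mul_of_pos_left (not_le.1 hcx) h_slope
          _ = s - 1 + H c := div_mul_cancel₀ _ hc_pos.ne'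
      have h_right : H c ≤ H y := H_strictMonoOn.monotoneOn ⟨hc_pos.le, hc_lt.le⟩ hy hcy
      linarith
    · exact mul_lt_mul_of_pos_left hxy h_slope
  · rw [fGMSW, if_neg (not_le.2 hc_pos), mul_zero]
  · rw [fGMSW, if_pos hc_lt.le, H_half]
    ring
end

section
/- Let s ∈ (0,1), let c = 1 − 2^{s−1}, and define f : [0,1/2] → ℝ by f(d) = s − 1 + H(d) if d ≥ c and f(d) = ((s − 1 + H(c))/c)·d if d < c. Then f is concave on [0,1/2]. -/
/-- A real function with a supporting line from above at each point of a convex set is concave. -/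
theorem concaveOn_of_exists_supporting_line {S : Set ℝ} (hS : Convex ℝ S) {f : ℝ → ℝ}
    (h : ∀ z ∈ S, ∃ k : ℝ, ∀ y ∈ S, f y ≤ f z + k * (y - z)) : ConcaveOn ℝ S f := by
  refine ⟨hS, fun x hx y hy a b ha hb hab => ?_⟩
  obtain ⟨k, hk⟩ := h _ (hS hx hy ha hb hab)
  have hx' := mul_le_mul_of_nonneg_left (hk x hx) ha
  have hy' := mul_le_mul_of_nonneg_left (hk y hy) hb
  simp only [smul_eq_mul] at *
  obtain rfl : b = 1 - a := by linarith
  linarith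

theorem mul_log_sub_log_le {y z : ℝ} (hy : 0 ≤ y) (hz : 0 < z) :
    y * (Real.log z - Real.log y) ≤ z - y := by
  rcases hy.eq_or_lt with rfl | hy
  · simpa using hz.le
  · rw [← Real.log_div hz.ne' hy.ne']
    have h := mul_le_mul_of_nonneg_left (Real.log_le_sub_one_of_pos (div_pos hz hy)) hy.le
    rwa [mul_sub, mul_div_cancel₀ _ hy.ne', mul_one] at h

/-- The tangent line of `H` at `z`, evaluated at `y`; it is the cross entropy of `y` and `z`. -/
noncomputable def entropyTangent (z y : ℝ) : ℝ :=
  -y * Real.logb 2 z - (1 - y) * Real.logb 2 (1 - z)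

theorem entropyTangent_self (z : ℝ) : entropyTangent z z = H z := rfl

theorem entropyTangent_eq (z x y : ℝ) : entropyTangent z y =
    entropyTangent z x + (Real.logb 2 (1 - z) - Real.logb 2 z) * (y - x) := by
  unfold entropyTangent
  ring

/-- The Gibbs inequality for two-point distributions. -/
theorem H_le_entropyTangent {y z : ℝ} (hy : y ∈ Set.Icc (0 : ℝ) 1) (hz : z ∈ Set.Ioo (0 : ℝ) 1) :
    H y ≤ entropyTangent z y := by
  have h₁ := mul_log_sub_log_le hy.1 hz.1
  have h₂ := mul_log_sub_log_le (sub_nonneg.2 hy.2) (sub_pos.2 hz.2)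
  have h : (y * (Real.log z - Real.log y) + (1 - y) * (Real.log (1 - z) - Real.log (1 - y)))
      / Real.log 2 ≤ 0 :=
    div_nonpos_of_nonpos_of_nonneg (by linarith) (Real.log_nonneg one_le_two)
  rw [← sub_nonpos]
  convert h using 1
  unfold H entropyTangent Real.logb
  ring

/-- To the left of `c`, the tangent line at `c` lies below the tangent line at any `z ≥ c`. -/
theorem entropyTangent_le_entropyTangent {y c z : ℝ} (hc : 0 < c) (hyc : y ≤ c) (hcz : c ≤ z)
    (hz : z < 1) : entropyTangent c y ≤ entropyTangent z y := by
  have h : H c ≤ entropyTangent z c :=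
    H_le_entropyTangent ⟨hc.le, by linarith⟩ ⟨by linarith, hz⟩
  have h₁ : Real.logb 2 c ≤ Real.logb 2 z := Real.logb_le_logb_of_le one_lt_two hc hcz
  have h₂ : Real.logb 2 (1 - z) ≤ Real.logb 2 (1 - c) :=
    Real.logb_le_logb_of_le one_lt_two (by linarith) (by linarith)
  rw [entropyTangent_eq c c, entropyTangent_eq z c, entropyTangent_self]
  exact add_le_add h (mul_le_mul_of_nonpos_right (by linarith) (by linarith))

/-- The linear piece of `fGMSW` is the tangent line of `s - 1 + H` at `1 - 2 ^ (s - 1)`. -/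
theorem fGMSW_of_le {s d : ℝ} (hs : s < 1) (hd : d ≤ 1 - (2 : ℝ) ^ (s - 1)) :
    fGMSW s d = s - 1 + entropyTangent (1 - (2 : ℝ) ^ (s - 1)) d := by
  have hc : (1 - (2 : ℝ) ^ (s - 1)) ≠ 0 :=
    (sub_pos.2 (Real.rpow_lt_one_of_one_lt_of_neg one_lt_two (by linarith))).ne'
  have hlog : Real.logb 2 (1 - (1 - (2 : ℝ) ^ (s - 1))) = s - 1 := by
    rw [sub_sub_cancel, Real.logb_rpow two_pos (by norm_num)]
  unfold fGMSW
  split_ifs with h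
  · rw [← le_antisymm hd h, entropyTangent_self]
  · unfold H entropyTangent
    rw [hlog]
    field_simp
    ring

theorem fGMSW_of_ge {s d : ℝ} (hd : 1 - (2 : ℝ) ^ (s - 1) ≤ d) : fGMSW s d = s - 1 + H d :=
  if_pos hd

/-- For `s` in `(0,1)`, the function `f` is concave on `[0, 1/2]`. -/
theorem stmt_13 (s : ℝ) (hs : s ∈ Set.Ioo (0 : ℝ) 1) :
    ConcaveOn ℝ (Set.Icc (0 : ℝ) (1 / 2)) (fGMSW s) := by
  obtain ⟨hs₀, hs₁⟩ := hs
  have hc₀ : 0 < 1 - (2 : ℝ) ^ (s - 1) :=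
    sub_pos.2 (Real.rpow_lt_one_of_one_lt_of_neg one_lt_two (by linarith))
  have hc₁ : 1 - (2 : ℝ) ^ (s - 1) < 1 := sub_lt_self _ (Real.rpow_pos_of_pos two_pos _)
  have hleft := fun d => fGMSW_of_le (d := d) hs₁
  have hright := fun d => fGMSW_of_ge (s := s) (d := d)
  generalize 1 - (2 : ℝ) ^ (s - 1) = c at hc₀ hc₁ hleft hright
  -- The tangent line at `max z c` supports the function at `z`.
  refine concaveOn_of_exists_supporting_line (convex_Icc _ _) fun z hz =>
    ⟨Real.logb 2 (1 - max z c) - Real.logb 2 (max z c), fun y hy => ?_⟩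
  have hm : max z c < 1 := max_lt (by linarith [hz.2]) hc₁
  have hfz : fGMSW s z = s - 1 + entropyTangent (max z c) z := by
    rcases le_total z c with h | h
    · rw [max_eq_right h, hleft z h]
    · rw [max_eq_left h, hright z h, entropyTangent_self]
  rw [hfz, add_assoc, ← entropyTangent_eq]
  rcases le_total y c with h | h
  · rw [hleft y h]
    gcongr
    exact entropyTangent_le_entropyTangent hc₀ h (le_max_right _ _) hm
  · rw [hright y h]
    gcongr
    exact H_le_entropyTangent ⟨hy.1, by linarith [hy.2]⟩ ⟨lt_max_of_lt_right hc₀, hm⟩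
end

section
/- For every p ∈ [0,1/2], 1 + (1/2)·H(2p) − (1−p)·H((1/2 − p)/(1−p)) = H(p), where for p = 1/2 the term (1−p)·H((1/2 − p)/(1−p)) is interpreted as (1/2)·H(0) = 0. -/
open Real in
/-- `x log₂ (x a) = x (log₂ x + log₂ a)`, valid also at `x = 0`. -/
lemma mul_logb_two_mul (x : ℝ) {a : ℝ} (ha : a ≠ 0) :
    x * logb 2 (x * a) = x * (logb 2 x + logb 2 a) := by
  rcases eq_or_ne x 0 with rfl | hx
  · simp
  · rw [logb_mul hx ha]

/-- For every `p` in `[0, 1/2]`,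
`1 + (1/2) H(2p) - (1-p) H((1/2 - p)/(1-p)) = H(p)`.
(At `p = 1/2` the last term is `(1/2) H(0) = 0`, which is what the formula gives.) -/
theorem stmt_16 (p : ℝ) (hp : p ∈ Set.Icc (0 : ℝ) (1 / 2)) :
    1 + (1 / 2) * H (2 * p) - (1 - p) * H ((1 / 2 - p) / (1 - p)) = H p := by
  have hp' : 1 - p ≠ 0 := by linarith [hp.2]
  have hone : Real.logb 2 2 = 1 := Real.logb_self_eq_one one_lt_two
  have hdouble := mul_logb_two_mul p two_ne_zero
  have hhalf := mul_logb_two_mul (1 / 2 - p) two_ne_zero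
  have hquot := mul_logb_two_mul (1 / 2 - p) (inv_ne_zero hp')
  have hcompl : 1 - (1 / 2 - p) / (1 - p) = (2 * (1 - p))⁻¹ := by field_simp; ring
  have hlog : Real.logb 2 (2 * (1 - p))⁻¹ = -(1 + Real.logb 2 (1 - p)) := by
    rw [Real.logb_inv, Real.logb_mul two_ne_zero hp', hone]
  have hscaled : (1 - p) * H ((1 / 2 - p) / (1 - p)) =
      -((1 / 2 - p) * Real.logb 2 ((1 / 2 - p) * (1 - p)⁻¹))
        + 1 / 2 * (1 + Real.logb 2 (1 - p)) := by
    rw [H, hcompl, hlog, ← div_eq_mul_inv]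
    field_simp
    ring
  rw [hscaled, hquot, H, H, Real.logb_inv, mul_comm 2 p,
    show 1 - p * 2 = (1 / 2 - p) * 2 by ring]
  rw [hone] at hdouble hhalf
  linear_combination -hdouble - hhalf
end

section
/- Let 0 < p < 1/2, let ε > 0, let 0 < δ < p, and let n be a natural number. Suppose S is a set of binary strings of length n such that |S| ≤ 2^{(H(p)−ε)·n} and every σ ∈ S has at least (p−δ)·n ones. Then μ_p(⋃_{σ∈S} [σ]) ≤ 2^{(−ε − δ·log₂(p) + δ·log₂(1−p))·n}, where [σ] = {X ∈ 2^ω : σ is a prefix of X} is the cylinder determined by σ. -/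
open MeasureTheory

/-- The cylinder `[σ] = {X ∈ 2^ω : σ is a prefix of X}` determined by a binary string
`σ` of length `m`. -/
def cyl {m : ℕ} (σ : Fin m → Bool) : Set (ℕ → Bool) :=
  {X | ∀ i : Fin m, X i = σ i}

/-- The number of ones in a binary string `σ` of length `m`. -/
def numOnes {m : ℕ} (σ : Fin m → Bool) : ℕ :=
  (Finset.univ.filter (fun i => σ i = true)).card

/-- `μ` is the Bernoulli(`p`) product measure on `2^ω`: the measure of the cylinder of
a string of length `m` with `k` ones is `p^k (1-p)^(m-k)` (this determines the measure
uniquely). -/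
def IsBernoulliMeasure (p : ℝ) (μ : Measure (ℕ → Bool)) : Prop :=
  ∀ (m : ℕ) (σ : Fin m → Bool),
    μ (cyl σ) = ENNReal.ofReal (p ^ numOnes σ * (1 - p) ^ (m - numOnes σ))

theorem numOnes_le {m : ℕ} (σ : Fin m → Bool) : numOnes σ ≤ m := by
  simpa [numOnes] using Finset.card_filter_le (Finset.univ : Finset (Fin m)) (fun i => σ i = true)

/-- For `p ≤ 1/2`, the weight `p^k (1-p)^(n-k)` of a string with `k ≥ a` ones is at most the
value of `p^x (1-p)^(n-x)` at `x = a`. -/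
theorem pow_mul_one_sub_pow_le {p a : ℝ} (hp0 : 0 < p) (hp2 : p ≤ 1 / 2) {k n : ℕ} (hkn : k ≤ n)
    (hak : a ≤ k) :
    p ^ k * (1 - p) ^ (n - k)
      ≤ (2 : ℝ) ^ (a * Real.logb 2 p + (n - a) * Real.logb 2 (1 - p)) := by
  have hq0 : 0 < 1 - p := by linarith
  have hlog : Real.logb 2 p ≤ Real.logb 2 (1 - p) :=
    Real.logb_le_logb_of_le (by norm_num) hp0 (by linarith)
  have hpow (x : ℝ) (hx : 0 < x) (j : ℕ) : x ^ j = (2 : ℝ) ^ (j * Real.logb 2 x) := by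
    rw [mul_comm, Real.rpow_mul (by norm_num),
      Real.rpow_logb (by norm_num) (by norm_num) hx, Real.rpow_natCast]
  rw [hpow p hp0, hpow (1 - p) hq0, ← Real.rpow_add (by norm_num), Nat.cast_sub hkn]
  apply Real.rpow_le_rpow_of_exponent_le (by norm_num)
  nlinarith [mul_nonneg (sub_nonneg.2 hak) (sub_nonneg.2 hlog)]

/-- Let `0 < p < 1/2`, `ε > 0`, `0 < δ < p`, and let `S` be a set of binary strings of
length `n` with `|S| ≤ 2^((H(p)-ε) n)`, each having at least `(p-δ) n` ones. Then
`μ_p(⋃_{σ∈S} [σ]) ≤ 2^((-ε - δ log2 p + δ log2 (1-p)) n)`. -/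
theorem stmt_17 (p ε δ : ℝ) (hp0 : 0 < p) (hp2 : p < 1 / 2) (hε : 0 < ε)
    (hδ0 : 0 < δ) (hδp : δ < p) (n : ℕ)
    (μ : Measure (ℕ → Bool)) (hμ : IsBernoulliMeasure p μ)
    (S : Finset (Fin n → Bool))
    (hcard : (S.card : ℝ) ≤ (2 : ℝ) ^ ((H p - ε) * n))
    (hones : ∀ σ ∈ S, (p - δ) * n ≤ (numOnes σ : ℝ)) :
    μ (⋃ σ ∈ S, cyl σ)
      ≤ ENNReal.ofReal
          ((2 : ℝ) ^ ((-ε - δ * Real.logb 2 p + δ * Real.logb 2 (1 - p)) * n)) := by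
  set B : ℝ := (2 : ℝ) ^ ((p - δ) * n * Real.logb 2 p + (n - (p - δ) * n) * Real.logb 2 (1 - p))
    with hB
  have hB0 : 0 ≤ B := by positivity
  calc μ (⋃ σ ∈ S, cyl σ)
      ≤ ∑ σ ∈ S, μ (cyl σ) := measure_biUnion_finset_le S _
    _ ≤ ∑ _σ ∈ S, ENNReal.ofReal B := by
        refine Finset.sum_le_sum fun σ hσ => ?_
        rw [hμ n σ]
        exact ENNReal.ofReal_le_ofReal
          (pow_mul_one_sub_pow_le hp0 hp2.le (numOnes_le σ) (hones σ hσ))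
    _ = ENNReal.ofReal (S.card * B) := by
        rw [Finset.sum_const, nsmul_eq_mul, ENNReal.ofReal_mul (Nat.cast_nonneg _),
          ENNReal.ofReal_natCast]
    _ ≤ _ := by
        refine ENNReal.ofReal_le_ofReal ((mul_le_mul_of_nonneg_right hcard hB0).trans_eq ?_)
        rw [hB, ← Real.rpow_add (by norm_num), H]
        congr 1
        ring
end

section
/- Let Y, B ∈ 2^ω each have infinitely many ones, with the positions of ones of Y enumerated in increasing order as y₀ < y₁ < y₂ < ⋯ and those of B as b₀ < b₁ < b₂ < ⋯. Suppose the density ρ(Y) = α and the density ρ(B) = β both exist. Let X ∈ 2^ω be the characteristic sequence of the set {y_{b_i} : i ∈ ℕ}. Then the density ρ(X) exists and equals α·β. -/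
theorem onesCount_eq_count (X : ℕ → Bool) (n : ℕ) :
    onesCount X n = Nat.count (fun m => X m = true) n :=
  (Nat.count_eq_card_filter_range _ n).symm

/-- Selecting the ones of `Y` along `B` composes the counting functions. -/
theorem onesCount_nth_comp {Y B X : ℕ → Bool}
    (hYinf : {n | Y n = true}.Infinite)
    (hX : ∀ m, X m = true ↔ ∃ k, B k = true ∧ m = Nat.nth (fun n => Y n = true) k) (n : ℕ) :
    onesCount X n = onesCount B (onesCount Y n) := by
  have key : (Finset.range n).filter (fun m => X m = true) =
      ((Finset.range (onesCount Y n)).filter (fun k => B k = true)).image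
        (Nat.nth (fun n => Y n = true)) := by
    ext m
    simp only [Finset.mem_filter, Finset.mem_range, Finset.mem_image, hX, onesCount_eq_count]
    constructor
    · rintro ⟨hm, k, hk, rfl⟩
      refine ⟨k, ⟨?_, hk⟩, rfl⟩
      have hlt := Nat.count_strict_mono (p := fun n => Y n = true)
        (Nat.nth_mem_of_infinite hYinf k) hm
      rwa [Nat.count_nth_of_infinite hYinf] at hlt
    · rintro ⟨k, ⟨hk, hB⟩, rfl⟩
      exact ⟨Nat.nth_lt_of_lt_count hk, k, hB, rfl⟩
  rw [onesCount, key, Finset.card_image_of_injective _ (Nat.nth_injective hYinf), ← onesCount]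

theorem tendsto_onesCount_atTop {Y : ℕ → Bool} (hYinf : {n | Y n = true}.Infinite) :
    Filter.Tendsto (onesCount Y) Filter.atTop Filter.atTop := by
  rw [funext (onesCount_eq_count Y)]
  refine Filter.tendsto_atTop_atTop_of_monotone (Nat.count_monotone _) fun k => ?_
  exact ⟨_, (Nat.count_nth_of_infinite hYinf k).ge⟩

/-- Suppose `Y` and `B` each have infinitely many ones, with densities `α` and `β`
respectively, the ones of `Y` being `y_0 < y_1 < ⋯` and those of `B` being
`b_0 < b_1 < ⋯`. If `X` is the characteristic sequence of `{y_{b_i} : i ∈ ℕ}`, then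
the density of `X` exists and equals `α β`. -/
theorem stmt_19 (Y B X : ℕ → Bool) (α β : ℝ)
    (hYinf : {n | Y n = true}.Infinite) (hBinf : {n | B n = true}.Infinite)
    (hYd : Filter.Tendsto (fun n => (onesCount Y n : ℝ) / n) Filter.atTop (nhds α))
    (hBd : Filter.Tendsto (fun n => (onesCount B n : ℝ) / n) Filter.atTop (nhds β))
    (hX : ∀ m, X m = true ↔
      ∃ i : ℕ, m = Nat.nth (fun n => Y n = true) (Nat.nth (fun n => B n = true) i)) :
    Filter.Tendsto (fun n => (onesCount X n : ℝ) / n) Filter.atTop (nhds (α * β)) := by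
  have hX' : ∀ m, X m = true ↔
      ∃ k, B k = true ∧ m = Nat.nth (fun n => Y n = true) k := fun m => by
    rw [hX]
    constructor
    · rintro ⟨i, hi⟩
      exact ⟨_, Nat.nth_mem_of_infinite hBinf i, hi⟩
    · rintro ⟨k, hk, hm⟩
      exact ⟨Nat.count (fun n => B n = true) k, by rw [hm, Nat.nth_count hk]⟩
  have htop := tendsto_onesCount_atTop hYinf
  refine (hYd.mul (hBd.comp htop)).congr' ?_
  filter_upwards [htop.eventually_gt_atTop 0] with n hn
  have hpos : (onesCount Y n : ℝ) ≠ 0 := by exact_mod_cast hn.ne'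
  rw [onesCount_nth_comp hYinf hX', Function.comp_apply, mul_comm, div_mul_div_cancel₀ hpos]
end
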